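/- arXiv:1402.5761 — 2 statements merged into one kernel-verified Lean document; each statement's English description precedes it below -/
import Mathlib

section
/- Let s₁, s₂, s₃, w₁, w₂, w₃, d₁, d₂, d₃ be real numbers with wᵢ ≠ 0, set gᵢ = (1 − (sᵢ/2)·ε𝐢)·(wᵢ·1 − 𝐤)·(1 − (dᵢ/2)·ε𝐤) for i = 1, 2, 3 as ℂ-dual quaternions, and set cᵢ = (wᵢ² − 1)/(wᵢ² + 1) and bᵢ = dᵢ·(wᵢ² + 1)/(2wᵢ). Suppose there exist α, β ∈ ℂ, a ∈ ℂ with a ≠ 0, and x₀ ∈ ℂ such that (I·1 − 𝐢)·g₁·(α·1 − 𝐢)·g₂·(β·1 − 𝐢)·g₃ = a·(1 + x₀·ε)·(𝐣 + I·𝐤). Then Q₁⁺(x₀) = 0. -/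
open Quaternion TrivSqZeroExt DualNumber

noncomputable section

/-- The ℂ-dual quaternions. -/
abbrev DQ : Type := DualNumber (Quaternion ℂ)

/-- The quaternion unit 𝐢, viewed as a dual quaternion. -/
def qi : DQ := inl (⟨0,1,0,0⟩ : ℍ[ℂ])
/-- The quaternion unit 𝐣, viewed as a dual quaternion. -/
def qj : DQ := inl (⟨0,0,1,0⟩ : ℍ[ℂ])
/-- The quaternion unit 𝐤, viewed as a dual quaternion. -/
def qk : DQ := inl (⟨0,0,0,1⟩ : ℍ[ℂ])

/-- A complex scalar, viewed as a dual quaternion. -/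
def cs (a : ℂ) : DQ := inl (algebraMap ℂ ℍ[ℂ] a)

/-- The joint dual quaternion `g = (1 - (s/2)ε𝐢)(w - 𝐤)(1 - (d/2)ε𝐤)`,
regarded as a ℂ-dual quaternion. -/
def g (s w d : ℝ) : DQ :=
  (1 - cs (s/2) * ε * qi) * (cs w - qk) * (1 - cs (d/2) * ε * qk)

@[simp] lemma re_fst_qi : (fst qi).re = 0 := rfl

@[simp] lemma imI_fst_qi : (fst qi).imI = 1 := rfl

@[simp] lemma imJ_fst_qi : (fst qi).imJ = 0 := rfl

@[simp] lemma imK_fst_qi : (fst qi).imK = 0 := rfl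

@[simp] lemma snd_qi : snd qi = 0 := rfl

@[simp] lemma re_fst_qj : (fst qj).re = 0 := rfl

@[simp] lemma imI_fst_qj : (fst qj).imI = 0 := rfl

@[simp] lemma imJ_fst_qj : (fst qj).imJ = 1 := rfl

@[simp] lemma imK_fst_qj : (fst qj).imK = 0 := rfl

@[simp] lemma snd_qj : snd qj = 0 := rfl

@[simp] lemma re_fst_qk : (fst qk).re = 0 := rfl

@[simp] lemma imI_fst_qk : (fst qk).imI = 0 := rfl

@[simp] lemma imJ_fst_qk : (fst qk).imJ = 0 := rfl

@[simp] lemma imK_fst_qk : (fst qk).imK = 1 := rfl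

@[simp] lemma snd_qk : snd qk = 0 := rfl

@[simp] lemma fst_cs (z : ℂ) : fst (cs z) = (z : ℍ[ℂ]) := rfl

@[simp] lemma snd_cs (z : ℂ) : snd (cs z) = 0 := rfl

/-- The upper left entry of a dual quaternion, in the `2 × 2` matrix representation
sending `𝐢` to `diag(-I, I)` and `𝐤` to `!![0, 1; -1, 0]`. -/
def entry₁₁ (q : DQ) : DualNumber ℂ :=
  inl ((fst q).re - Complex.I * (fst q).imI) + inr ((snd q).re - Complex.I * (snd q).imI)

/-- The upper right entry of a dual quaternion, in the same representation as `entry₁₁`. -/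
def entry₁₂ (q : DQ) : DualNumber ℂ :=
  inl (Complex.I * (fst q).imJ + (fst q).imK) + inr (Complex.I * (snd q).imJ + (snd q).imK)

/-- The lower left entry of a dual quaternion, in the same representation as `entry₁₁`. -/
def entry₂₁ (q : DQ) : DualNumber ℂ :=
  inl (Complex.I * (fst q).imJ - (fst q).imK) + inr (Complex.I * (snd q).imJ - (snd q).imK)

/-- The lower right entry of a dual quaternion, in the same representation as `entry₁₁`. -/
def entry₂₂ (q : DQ) : DualNumber ℂ :=
  inl ((fst q).re + Complex.I * (fst q).imI) + inr ((snd q).re + Complex.I * (snd q).imI)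

lemma entry₁₁_mul (p q : DQ) :
    entry₁₁ (p * q) = entry₁₁ p * entry₁₁ q + entry₁₂ p * entry₂₁ q := by
  ext <;> (simp [entry₁₁, entry₁₂, entry₂₁]; ring_nf; simp only [Complex.I_sq]; ring)

lemma entry₁₂_mul (p q : DQ) :
    entry₁₂ (p * q) = entry₁₁ p * entry₁₂ q + entry₁₂ p * entry₂₂ q := by
  ext <;> (simp [entry₁₁, entry₁₂, entry₂₂]; ring_nf; simp only [Complex.I_sq]; ring)

lemma entry₁₁_g (s w d : ℝ) :
    entry₁₁ (g s w d) = inl (w : ℂ) + inr (Complex.I * s / 2 * w - d / 2) := by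
  ext
  · simp [entry₁₁, g]
  · simp [entry₁₁, g]
    ring

lemma entry₁₂_g (s w d : ℝ) :
    entry₁₂ (g s w d) = inl (-1 : ℂ) + inr (-(Complex.I * s / 2) - w * d / 2) := by
  ext
  · simp [entry₁₂, g]
  · simp [entry₁₂, g]
    ring

lemma entry₂₁_g (s w d : ℝ) :
    entry₂₁ (g s w d) = inl (1 : ℂ) + inr (w * d / 2 - Complex.I * s / 2) := by
  ext
  · simp [entry₂₁, g]
  · simp [entry₂₁, g]
    ring

lemma entry₂₂_g (s w d : ℝ) :
    entry₂₂ (g s w d) = inl (w : ℂ) + inr (-(Complex.I * s / 2 * w) - d / 2) := by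
  ext
  · simp [entry₂₂, g]
  · simp [entry₂₂, g]
    ring

lemma entry₁₁_cs_sub_qi (z : ℂ) : entry₁₁ (cs z - qi) = inl (z + Complex.I) := by
  ext <;> simp [entry₁₁]

lemma entry₁₂_cs_sub_qi (z : ℂ) : entry₁₂ (cs z - qi) = 0 := by
  ext <;> simp [entry₁₂]

lemma entry₂₁_cs_sub_qi (z : ℂ) : entry₂₁ (cs z - qi) = 0 := by
  ext <;> simp [entry₂₁]

lemma entry₂₂_cs_sub_qi (z : ℂ) : entry₂₂ (cs z - qi) = inl (z - Complex.I) := by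
  ext <;> simp [entry₂₂, sub_eq_add_neg]

lemma entry₁₁_qj_add (a x : ℂ) :
    entry₁₁ (cs a * (1 + cs x * ε) * (qj + cs Complex.I * qk)) = 0 := by
  ext <;> simp [entry₁₁]

lemma entry₁₂_qj_add (a x : ℂ) :
    entry₁₂ (cs a * (1 + cs x * ε) * (qj + cs Complex.I * qk)) =
      inl (2 * Complex.I * a) + inr (2 * Complex.I * a * x) := by
  ext <;> simp [entry₁₂] <;> ring

/-- Eliminating the linkage parameters: the two homogeneous linear equations satisfied by
`(u, v) ≠ 0` have vanishing determinant. -/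
lemma det_eq_zero_of_bond_entries {σ₁ σ₂ σ₃ w₁ w₂ w₃ d₁ d₂ d₃ u v p m a x : ℂ}
    (hw₃ : w₃ ≠ 0) (hw₃' : w₃ ^ 2 + 1 ≠ 0) (ha : a ≠ 0) (huv : u ≠ v)
    {X₀ X₁ Y₀ Y₁ : ℂ}
    (hX₀ : X₀ = w₁ * w₂ * u - v)
    (hX₁ : X₁ = (w₁ * w₂ * σ₂ - (d₁ * w₂ + w₁ * d₂) / 2) * u + (σ₂ - (w₁ * d₁ + w₂ * d₂) / 2) * v)
    (hY₀ : Y₀ = w₁ * u + w₂ * v)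
    (hY₁ : Y₁ = (w₁ * σ₂ - d₁ / 2 + w₁ * w₂ * d₂ / 2) * u +
      (w₁ * d₁ * w₂ / 2 - d₂ / 2 - w₂ * σ₂) * v)
    (h₁ : X₀ * p * w₃ - Y₀ * m = 0)
    (h₂ : X₀ * p + Y₀ * m * w₃ = -a)
    (h₁' : (X₁ + σ₁ * X₀) * p * w₃ + X₀ * p * (σ₃ * w₃ - d₃ / 2)
      - (Y₁ + σ₁ * Y₀) * m - Y₀ * m * (w₃ * d₃ / 2 - σ₃) = 0)
    (h₂' : (X₁ + σ₁ * X₀) * p + X₀ * p * (σ₃ + w₃ * d₃ / 2)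
      + (Y₁ + σ₁ * Y₀) * m * w₃ + Y₀ * m * (-(σ₃ * w₃) - d₃ / 2) = -(a * x)) :
    (w₁ * w₂ * σ₂ - (d₁ * w₂ + w₁ * d₂) / 2 - (x - σ₁ - σ₃ + d₃ * w₃ / 2) * (w₁ * w₂)) *
        (w₁ * d₁ * w₂ / 2 - d₂ / 2 - w₂ * σ₂ - (x - σ₁ + σ₃ - d₃ / (2 * w₃)) * w₂) -
      (σ₂ - (w₁ * d₁ + w₂ * d₂) / 2 + (x - σ₁ - σ₃ + d₃ * w₃ / 2)) *
        (w₁ * σ₂ - d₁ / 2 + w₁ * w₂ * d₂ / 2 - (x - σ₁ + σ₃ - d₃ / (2 * w₃)) * w₁) = 0 := by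
  have hXp : X₀ * p * (w₃ ^ 2 + 1) = -a := by linear_combination w₃ * h₁ + h₂
  have hYm : Y₀ * m * (w₃ ^ 2 + 1) = -(a * w₃) := by linear_combination w₃ * h₂ - h₁
  have hp : p ≠ 0 := by
    rintro rfl
    exact ha (by linear_combination hXp)
  have hm : m ≠ 0 := by
    rintro rfl
    exact mul_ne_zero ha hw₃ (by linear_combination hYm)
  have hX : X₁ - (x - σ₁ - σ₃ + d₃ * w₃ / 2) * X₀ = 0 := by
    have : (X₁ - (x - σ₁ - σ₃ + d₃ * w₃ / 2) * X₀) * (p * (w₃ ^ 2 + 1)) = 0 := by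
      linear_combination w₃ * h₁' + h₂' - x * hXp - d₃ / 2 * (w₃ ^ 2 + 1) * h₁
    exact (mul_eq_zero.mp this).resolve_right (mul_ne_zero hp hw₃')
  have hY : Y₁ - (x - σ₁ + σ₃ - d₃ / (2 * w₃)) * Y₀ = 0 := by
    have : (Y₁ - (x - σ₁ + σ₃ - d₃ / (2 * w₃)) * Y₀) * (m * (w₃ ^ 2 + 1)) = 0 := by
      field_simp
      linear_combination 2 * w₃ * (w₃ * h₂' - h₁' - x * hYm) - d₃ * (w₃ ^ 2 + 1) * h₁
    exact (mul_eq_zero.mp this).resolve_right (mul_ne_zero hm hw₃')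
  subst hX₀ hX₁ hY₀ hY₁
  refine (mul_eq_zero.mp ?_).resolve_right (sub_ne_zero.mpr huv)
  linear_combination
    (w₁ * d₁ * w₂ / 2 - d₂ / 2 - w₂ * σ₂ - (x - σ₁ + σ₃ - d₃ / (2 * w₃)) * w₂ +
      (w₁ * σ₂ - d₁ / 2 + w₁ * w₂ * d₂ / 2 - (x - σ₁ + σ₃ - d₃ / (2 * w₃)) * w₁)) * hX -
    (w₁ * w₂ * σ₂ - (d₁ * w₂ + w₁ * d₂) / 2 - (x - σ₁ - σ₃ + d₃ * w₃ / 2) * (w₁ * w₂) +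
      (σ₂ - (w₁ * d₁ + w₂ * d₂) / 2 + (x - σ₁ - σ₃ + d₃ * w₃ / 2))) * hY

/-- If the bond product `(I - 𝐢)g₁(α - 𝐢)g₂(β - 𝐢)g₃` equals `a(1 + x₀ε)(𝐣 + I𝐤)`
with `a ≠ 0`, then `x₀` is a root of the quad polynomial `Q₁⁺`. -/
theorem quad_polynomial_root
    (s₁ s₂ s₃ w₁ w₂ w₃ d₁ d₂ d₃ : ℝ)
    (hw₁ : w₁ ≠ 0) (hw₂ : w₂ ≠ 0) (hw₃ : w₃ ≠ 0)
    (b₁ b₂ b₃ c₁ c₂ c₃ : ℝ)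
    (hb₁ : b₁ = d₁ * (w₁^2 + 1) / (2 * w₁))
    (hb₂ : b₂ = d₂ * (w₂^2 + 1) / (2 * w₂))
    (hb₃ : b₃ = d₃ * (w₃^2 + 1) / (2 * w₃))
    (hc₁ : c₁ = (w₁^2 - 1) / (w₁^2 + 1))
    (hc₂ : c₂ = (w₂^2 - 1) / (w₂^2 + 1))
    (hc₃ : c₃ = (w₃^2 - 1) / (w₃^2 + 1))
    (α β a x₀ : ℂ) (ha : a ≠ 0)
    (hbond : (cs Complex.I - qi) * g s₁ w₁ d₁ * (cs α - qi) * g s₂ w₂ d₂ *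
        (cs β - qi) * g s₃ w₃ d₃ = cs a * (1 + cs x₀ * ε) * (qj + cs Complex.I * qk)) :
    (x₀ + ((b₃ * c₃ - b₁ * c₁ : ℝ) : ℂ) / 2 - ((s₁ : ℝ) : ℂ) / 2 * Complex.I)^2
      + Complex.I / 2 * ((b₁ * s₂ + b₃ * s₃ + s₂ * b₃ * c₂ + s₃ * b₁ * c₂ : ℝ) : ℂ)
      - ((b₁ * b₃ * c₂ - s₂ * s₃ * c₂ : ℝ) : ℂ) / 2
      + ((s₂^2 + s₃^2 - b₁^2 + b₂^2 - b₃^2 - b₂^2 * c₂^2 : ℝ) : ℂ) / 4 = 0 := by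
  have h₁ := congrArg entry₁₁ hbond
  have h₂ := congrArg entry₁₂ hbond
  rw [entry₁₁_qj_add] at h₁
  rw [entry₁₂_qj_add] at h₂
  simp only [entry₁₁_mul, entry₁₂_mul, entry₁₁_cs_sub_qi, entry₁₂_cs_sub_qi, entry₂₁_cs_sub_qi,
    entry₂₂_cs_sub_qi, zero_mul, mul_zero, add_zero, zero_add, entry₁₁_g, entry₁₂_g, entry₂₁_g,
    entry₂₂_g] at h₁ h₂
  have h₁_fst := congrArg fst h₁
  have h₂_fst := congrArg fst h₂
  have h₁_snd := congrArg snd h₁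
  have h₂_snd := congrArg snd h₂
  simp only [fst_add, fst_mul, fst_inl, fst_inr, snd_add, DualNumber.snd_mul, snd_inl, snd_inr,
    fst_zero, snd_zero] at h₁_fst h₂_fst h₁_snd h₂_snd
  have h2I : 2 * Complex.I ≠ 0 := by simp
  have hw (w : ℝ) : (w : ℂ) ^ 2 + 1 ≠ 0 := by
    exact_mod_cast (by positivity : w ^ 2 + 1 ≠ 0)
  have hw₁c : (w₁ : ℂ) ≠ 0 := by exact_mod_cast hw₁
  have hw₂c : (w₂ : ℂ) ≠ 0 := by exact_mod_cast hw₂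
  have hw₃c : (w₃ : ℂ) ≠ 0 := by exact_mod_cast hw₃
  have hdet := det_eq_zero_of_bond_entries (σ₁ := Complex.I * s₁ / 2) (σ₂ := Complex.I * s₂ / 2)
    (σ₃ := Complex.I * s₃ / 2) (w₁ := w₁) (w₂ := w₂) (d₁ := d₁) (d₂ := d₂) (d₃ := d₃)
    (u := α + Complex.I) (v := α - Complex.I) (p := β + Complex.I) (m := β - Complex.I) (x := x₀)
    hw₃c (hw w₃) ha
    (fun h => h2I (by linear_combination h)) rfl rfl rfl rfl
    (mul_left_cancel₀ h2I (by linear_combination h₁_fst))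
    (mul_left_cancel₀ h2I (by linear_combination -h₂_fst))
    (mul_left_cancel₀ h2I (by linear_combination h₁_snd))
    (mul_left_cancel₀ h2I (by linear_combination -h₂_snd))
  have hlead : (w₁ : ℂ) * (w₂ ^ 2 + 1) ≠ 0 := mul_ne_zero hw₁c (hw w₂)
  refine (mul_eq_zero.mp ?_).resolve_left hlead
  have h1 := hw w₁
  have h2 := hw w₂
  have h3 := hw w₃
  subst hb₁ hb₂ hb₃ hc₁ hc₂ hc₃
  push_cast
  rw [← hdet]
  field_simp
  ring_nf
  simp only [Complex.I_sq]
  ring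
end
end

section
/- Let s₁, s₂, s₃, w₁, w₂, w₃, d₁, d₂, d₃ be real numbers with wᵢ ≠ 0, set gᵢ = (1 − (sᵢ/2)·ε𝐢)·(wᵢ·1 − 𝐤)·(1 − (dᵢ/2)·ε𝐤) for i = 1, 2, 3 as ℂ-dual quaternions, and set cᵢ = (wᵢ² − 1)/(wᵢ² + 1) and bᵢ = dᵢ·(wᵢ² + 1)/(2wᵢ). Suppose α, β ∈ ℂ with α, β ∉ {I, −I} satisfy (I·1 − 𝐢)·g₁·(α·1 − 𝐢)·g₂·(β·1 − 𝐢)·g₃·(I·1 − 𝐢) = 0. Then there exist a ∈ ℂ with a ≠ 0 and x₀ ∈ ℂ such that (I·1 − 𝐢)·g₁·(α·1 − 𝐢)·g₂·(β·1 − 𝐢)·g₃ = a·(1 + x₀·ε)·(𝐣 + I·𝐤) and Q₁⁺(x₀) = 0. -/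
open Quaternion TrivSqZeroExt DualNumber

noncomputable section

theorem qi_components : qi.fst.re = 0 ∧ qi.fst.imI = 1 ∧ qi.fst.imJ = 0 ∧ qi.fst.imK = 0 ∧
    qi.snd = 0 := ⟨rfl, rfl, rfl, rfl, rfl⟩

theorem qj_components : qj.fst.re = 0 ∧ qj.fst.imI = 0 ∧ qj.fst.imJ = 1 ∧ qj.fst.imK = 0 ∧
    qj.snd = 0 := ⟨rfl, rfl, rfl, rfl, rfl⟩

theorem qk_components : qk.fst.re = 0 ∧ qk.fst.imI = 0 ∧ qk.fst.imJ = 0 ∧ qk.fst.imK = 1 ∧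
    qk.snd = 0 := ⟨rfl, rfl, rfl, rfl, rfl⟩

/-- The dual quaternion `(x + x'ε)(I - 𝐢) + (y + y'ε)(𝐣 + I𝐤)`. These form the right ideal
generated by `I - 𝐢`. -/
def idealElt (x x' y y' : ℂ) : DQ :=
  (cs x + cs x' * ε) * (cs Complex.I - qi) + (cs y + cs y' * ε) * (qj + cs Complex.I * qk)

theorem fst_idealElt (x x' y y' : ℂ) :
    (idealElt x x' y y').fst.re = Complex.I * x ∧ (idealElt x x' y y').fst.imI = -x ∧
      (idealElt x x' y y').fst.imJ = y ∧ (idealElt x x' y y').fst.imK = Complex.I * y := by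
  refine ⟨?_, ?_, ?_, ?_⟩ <;>
    simp [idealElt, cs, qi_components, qj_components, qk_components, mul_comm]

theorem snd_idealElt (x x' y y' : ℂ) :
    (idealElt x x' y y').snd.re = Complex.I * x' ∧ (idealElt x x' y y').snd.imI = -x' ∧
      (idealElt x x' y y').snd.imJ = y' ∧ (idealElt x x' y y').snd.imK = Complex.I * y' := by
  refine ⟨?_, ?_, ?_, ?_⟩ <;>
    simp [idealElt, cs, qi_components, qj_components, qk_components, mul_comm]

theorem idealElt_mul_sub_qi (x x' y y' α : ℂ) :
    idealElt x x' y y' * (cs α - qi) =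
      idealElt ((α + Complex.I) * x) ((α + Complex.I) * x')
        ((α - Complex.I) * y) ((α - Complex.I) * y') := by
  refine TrivSqZeroExt.ext ?_ ?_ <;> ext <;>
    simp [fst_idealElt, snd_idealElt, cs, qi_components, -MulOpposite.op_sub] <;>
    ring_nf <;> simp only [Complex.I_sq] <;> ring

theorem idealElt_mul_one_sub_qi (x x' y y' s : ℂ) :
    idealElt x x' y y' * (1 - cs s * ε * qi) =
      idealElt x (x' + Complex.I * s * x) y (y' - Complex.I * s * y) := by
  refine TrivSqZeroExt.ext ?_ ?_ <;> ext <;>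
    simp [fst_idealElt, snd_idealElt, cs, qi_components, -MulOpposite.op_sub] <;>
    ring_nf <;> simp only [Complex.I_sq] <;> ring

theorem idealElt_mul_sub_qk (x x' y y' w : ℂ) :
    idealElt x x' y y' * (cs w - qk) =
      idealElt (w * x + y) (w * x' + y') (w * y - x) (w * y' - x') := by
  refine TrivSqZeroExt.ext ?_ ?_ <;> ext <;>
    simp [fst_idealElt, snd_idealElt, cs, qk_components, -MulOpposite.op_sub] <;>
    ring

theorem idealElt_mul_one_sub_qk (x x' y y' d : ℂ) :
    idealElt x x' y y' * (1 - cs d * ε * qk) =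
      idealElt x (x' + d * y) y (y' - d * x) := by
  refine TrivSqZeroExt.ext ?_ ?_ <;> ext <;>
    simp [fst_idealElt, snd_idealElt, cs, qk_components, -MulOpposite.op_sub] <;>
    ring

theorem eq_zero_of_idealElt_eq_zero {x x' y y' : ℂ} (h : idealElt x x' y y' = 0) :
    x = 0 ∧ x' = 0 := by
  have h₁ := congrArg (fun q : DQ => q.fst.imI) h
  have h₂ := congrArg (fun q : DQ => q.snd.imI) h
  simpa [fst_idealElt, snd_idealElt] using And.intro h₁ h₂

theorem idealElt_zero_zero {y : ℂ} (hy : y ≠ 0) (y' : ℂ) :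
    idealElt 0 0 y y' = cs y * (1 + cs (y' / y) * ε) * (qj + cs Complex.I * qk) := by
  have h : cs y' = cs y * cs (y' / y) := by
    simp only [cs, ← inl_mul, ← map_mul, mul_div_cancel₀ y' hy]
  have h₀ : cs 0 = 0 := by simp [cs]
  rw [idealElt, h, h₀, mul_add (cs y), mul_one, mul_assoc (cs y)]
  simp

theorem idealElt_mul_g (x x' y y' : ℂ) (s w d : ℝ) :
    idealElt x x' y y' * g s w d =
      idealElt (w * x + y)
        (w * (x' + Complex.I * (s / 2) * x) + (y' - Complex.I * (s / 2) * y)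
          + d / 2 * (w * y - x))
        (w * y - x)
        (w * (y' - Complex.I * (s / 2) * y) - (x' + Complex.I * (s / 2) * x)
          - d / 2 * (w * x + y)) := by
  rw [g, ← mul_assoc, ← mul_assoc, idealElt_mul_one_sub_qi, idealElt_mul_sub_qk,
    idealElt_mul_one_sub_qk]

theorem ofReal_sq_add_one_ne_zero (w : ℝ) : (w : ℂ) ^ 2 + 1 ≠ 0 := by
  exact_mod_cast (by positivity : w ^ 2 + 1 ≠ 0)

/-- The algebraic core: `(x, y)` are the coordinates of `(I - 𝐢)g₁(α - 𝐢)g₂` in the ideal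
generated by `I - 𝐢`, with `A, B` standing for `α ± I` and `C, D` for `β ± I`. If the
`I - 𝐢` coordinate of the full product vanishes, the other coordinate `Y + Y'ε` is invertible
and `Y' / Y` is a root of the quad polynomial. -/
theorem quad_eq_zero {e s₁ s₂ s₃ w₁ w₂ w₃ d₁ d₂ d₃ b₁ b₂ b₃ c₁ c₂ c₃ A B C D x x' y y' Y Y' : ℂ}
    (he : e ^ 2 = -1) (hw₃ : w₃ ≠ 0)
    (hn₁ : w₁ ^ 2 + 1 ≠ 0) (hn₂ : w₂ ^ 2 + 1 ≠ 0) (hn₃ : w₃ ^ 2 + 1 ≠ 0)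
    (hd₁ : d₁ = 2 * b₁ * w₁ / (w₁ ^ 2 + 1))
    (hd₂ : d₂ = 2 * b₂ * w₂ / (w₂ ^ 2 + 1))
    (hd₃ : d₃ = 2 * b₃ * w₃ / (w₃ ^ 2 + 1))
    (hc₁ : c₁ = (w₁ ^ 2 - 1) / (w₁ ^ 2 + 1))
    (hc₂ : c₂ = (w₂ ^ 2 - 1) / (w₂ ^ 2 + 1))
    (hc₃ : c₃ = (w₃ ^ 2 - 1) / (w₃ ^ 2 + 1))
    (hB : B ≠ 0) (hC : C ≠ 0) (hD : D ≠ 0)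
    (hx : x = w₁ * w₂ * A - B)
    (hx' : x' = A * w₂ * (e * (s₁ + s₂) / 2 * w₁ - d₁ / 2)
      - B * (e * (s₁ - s₂) / 2 + d₁ / 2 * w₁) - d₂ / 2 * (w₁ * A + w₂ * B))
    (hy : y = -(w₁ * A + w₂ * B))
    (hy' : y' = -A * (e * (s₁ + s₂) / 2 * w₁ - d₁ / 2)
      - B * w₂ * (e * (s₁ - s₂) / 2 + d₁ / 2 * w₁) - d₂ / 2 * (w₁ * w₂ * A - B))
    (h₀ : w₃ * (C * x) + D * y = 0)
    (h₁ : w₃ * (C * x' + e * (s₃ / 2) * (C * x)) + (D * y' - e * (s₃ / 2) * (D * y))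
      + d₃ / 2 * (w₃ * (D * y) - C * x) = 0)
    (hY : Y = w₃ * (D * y) - C * x)
    (hY' : Y' = w₃ * (D * y' - e * (s₃ / 2) * (D * y)) - (C * x' + e * (s₃ / 2) * (C * x))
      - d₃ / 2 * (w₃ * (C * x) + D * y)) :
    Y ≠ 0 ∧ (Y' / Y + (b₃ * c₃ - b₁ * c₁) / 2 - s₁ / 2 * e) ^ 2
        + e / 2 * (b₁ * s₂ + b₃ * s₃ + s₂ * b₃ * c₂ + s₃ * b₁ * c₂)
        - (b₁ * b₃ * c₂ - s₂ * s₃ * c₂) / 2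
        + (s₂ ^ 2 + s₃ ^ 2 - b₁ ^ 2 + b₂ ^ 2 - b₃ ^ 2 - b₂ ^ 2 * c₂ ^ 2) / 4 = 0 := by
  have hx0 : x ≠ 0 := by
    intro h
    have hy0 : y = 0 := by simpa [h, hD] using h₀
    exact mul_ne_zero hB hn₂ (by linear_combination hx - h - w₂ * (hy0 - hy))
  have hYx : Y = -(w₃ ^ 2 + 1) * C * x := by linear_combination hY + w₃ * h₀
  have hY0 : Y ≠ 0 := by
    rw [hYx]
    exact mul_ne_zero (mul_ne_zero (neg_ne_zero.2 hn₃) hC) hx0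
  have hDy : D * y = -w₃ * C * x := by linear_combination h₀
  have hE : (b₂ * w₂ * B + w₁ * A * (b₁ - e * s₂)) * x =
      (w₂ * B + w₁ * A) * ((b₃ - e * s₃) * x + w₁ * w₂ * A * (b₁ - e * s₂ + b₂)) := by
    have h : w₃ * (C * x' * y + e * s₃ * C * x * y) - w₃ * C * x * y'
        - d₃ / 2 * (w₃ ^ 2 + 1) * C * x * y = 0 := by
      linear_combination y * h₁ - (y' - e * s₃ / 2 * y + d₃ / 2 * w₃ * y) * h₀
    have hwC : -w₃ * C ≠ 0 := mul_ne_zero (neg_ne_zero.2 hw₃) hC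
    apply mul_left_cancel₀ hwC
    rw [← sub_eq_zero, ← h, hx', hy', hd₁, hd₂, hd₃]
    field_simp
    rw [hx, hy]
    ring
  have hK : Y' / Y + (b₃ * c₃ - b₁ * c₁) / 2 - s₁ / 2 * e =
      (b₁ - e * s₂ - (b₃ - e * s₃) + b₂ * (1 + c₂)) / 2
        - w₁ * w₂ * A * (b₁ - e * s₂ + b₂) / x := by
    have hY'x : Y' = -(w₃ ^ 2 + 1) * (C * x' + e * (s₃ / 2) * (C * x))
        - d₃ / 2 * (w₃ ^ 2 + 1) * (D * y) := by
      linear_combination hY' + w₃ * h₁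
    rw [hY'x, hYx, hDy, hx', hd₁, hd₂, hd₃, hc₁, hc₂, hc₃]
    field_simp
    rw [hx]
    ring
  refine ⟨hY0, ?_⟩
  rw [hK, hc₂]
  field_simp
  rw [hx] at hE ⊢
  linear_combination (-16 * (w₂ ^ 2 + 1) * w₂ * (b₁ - e * s₂ + b₂)) * hE
    + 4 * (w₂ ^ 2 + 1) * (w₁ * w₂ * A - B) ^ 2 *
      ((s₂ ^ 2 + s₃ ^ 2) * (w₂ ^ 2 + 1) + 2 * s₂ * s₃ * (w₂ ^ 2 - 1)) * he

theorem partial_product_eq_idealElt (s₁ s₂ w₁ w₂ d₁ d₂ : ℝ) (α : ℂ) :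
    (cs Complex.I - qi) * g s₁ w₁ d₁ * (cs α - qi) * g s₂ w₂ d₂ =
      idealElt (w₁ * w₂ * (α + Complex.I) - (α - Complex.I))
        ((α + Complex.I) * w₂ * (Complex.I * (s₁ + s₂) / 2 * w₁ - d₁ / 2)
          - (α - Complex.I) * (Complex.I * (s₁ - s₂) / 2 + d₁ / 2 * w₁)
          - d₂ / 2 * (w₁ * (α + Complex.I) + w₂ * (α - Complex.I)))
        (-(w₁ * (α + Complex.I) + w₂ * (α - Complex.I)))
        (-(α + Complex.I) * (Complex.I * (s₁ + s₂) / 2 * w₁ - d₁ / 2)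
          - (α - Complex.I) * w₂ * (Complex.I * (s₁ - s₂) / 2 + d₁ / 2 * w₁)
          - d₂ / 2 * (w₁ * w₂ * (α + Complex.I) - (α - Complex.I))) := by
  have hu : cs Complex.I - qi = idealElt 1 0 0 0 := by simp [idealElt, cs]
  rw [hu, idealElt_mul_g, idealElt_mul_sub_qi, idealElt_mul_g]
  congr 1 <;> ring

theorem eq_div_of_eq_mul_add_one_div {b d w : ℂ} (hw : w ≠ 0) (hn : w ^ 2 + 1 ≠ 0)
    (hb : b = d * (w ^ 2 + 1) / (2 * w)) : d = 2 * b * w / (w ^ 2 + 1) := by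
  rw [hb]
  field_simp

/-- A far connection of joints 1 and 4 with `t₁ = t₄ = I` forces the partial product
`(I - 𝐢)g₁(α - 𝐢)g₂(β - 𝐢)g₃` to be of the form `a(1 + x₀ε)(𝐣 + I𝐤)` with `a ≠ 0`
and `x₀` a root of the quad polynomial `Q₁⁺`. -/
theorem far_connection_gives_quad_root
    (s₁ s₂ s₃ w₁ w₂ w₃ d₁ d₂ d₃ : ℝ)
    (hw₁ : w₁ ≠ 0) (hw₂ : w₂ ≠ 0) (hw₃ : w₃ ≠ 0)
    (b₁ b₂ b₃ c₁ c₂ c₃ : ℝ)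
    (hb₁ : b₁ = d₁ * (w₁^2 + 1) / (2 * w₁))
    (hb₂ : b₂ = d₂ * (w₂^2 + 1) / (2 * w₂))
    (hb₃ : b₃ = d₃ * (w₃^2 + 1) / (2 * w₃))
    (hc₁ : c₁ = (w₁^2 - 1) / (w₁^2 + 1))
    (hc₂ : c₂ = (w₂^2 - 1) / (w₂^2 + 1))
    (hc₃ : c₃ = (w₃^2 - 1) / (w₃^2 + 1))
    (α β : ℂ)
    (hα : α ≠ Complex.I ∧ α ≠ -Complex.I)
    (hβ : β ≠ Complex.I ∧ β ≠ -Complex.I)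
    (hbond : (cs Complex.I - qi) * g s₁ w₁ d₁ * (cs α - qi) * g s₂ w₂ d₂ *
        (cs β - qi) * g s₃ w₃ d₃ * (cs Complex.I - qi) = 0) :
    ∃ a x₀ : ℂ, a ≠ 0 ∧
      (cs Complex.I - qi) * g s₁ w₁ d₁ * (cs α - qi) * g s₂ w₂ d₂ *
        (cs β - qi) * g s₃ w₃ d₃ = cs a * (1 + cs x₀ * ε) * (qj + cs Complex.I * qk) ∧
      (x₀ + ((b₃ * c₃ - b₁ * c₁ : ℝ) : ℂ) / 2 - ((s₁ : ℝ) : ℂ) / 2 * Complex.I)^2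
        + Complex.I / 2 * ((b₁ * s₂ + b₃ * s₃ + s₂ * b₃ * c₂ + s₃ * b₁ * c₂ : ℝ) : ℂ)
        - ((b₁ * b₃ * c₂ - s₂ * s₃ * c₂ : ℝ) : ℂ) / 2
        + ((s₂^2 + s₃^2 - b₁^2 + b₂^2 - b₃^2 - b₂^2 * c₂^2 : ℝ) : ℂ) / 4 = 0 := by
  rw [partial_product_eq_idealElt, idealElt_mul_sub_qi, idealElt_mul_g] at hbond ⊢
  rw [idealElt_mul_sub_qi] at hbond
  have h2I : Complex.I + Complex.I ≠ 0 := by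
    rw [← two_mul]
    exact mul_ne_zero two_ne_zero Complex.I_ne_zero
  obtain ⟨h₀, h₁⟩ := eq_zero_of_idealElt_eq_zero hbond
  replace h₀ := (mul_eq_zero.1 h₀).resolve_left h2I
  replace h₁ := (mul_eq_zero.1 h₁).resolve_left h2I
  have hw₁' : (w₁ : ℂ) ≠ 0 := by exact_mod_cast hw₁
  have hw₂' : (w₂ : ℂ) ≠ 0 := by exact_mod_cast hw₂
  have hw₃' : (w₃ : ℂ) ≠ 0 := by exact_mod_cast hw₃
  have hn₁ := ofReal_sq_add_one_ne_zero w₁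
  have hn₂ := ofReal_sq_add_one_ne_zero w₂
  have hn₃ := ofReal_sq_add_one_ne_zero w₃
  obtain ⟨hY, hQ⟩ := quad_eq_zero Complex.I_sq hw₃' hn₁ hn₂ hn₃
    (eq_div_of_eq_mul_add_one_div (b := b₁) hw₁' hn₁ (by exact_mod_cast hb₁))
    (eq_div_of_eq_mul_add_one_div (b := b₂) hw₂' hn₂ (by exact_mod_cast hb₂))
    (eq_div_of_eq_mul_add_one_div (b := b₃) hw₃' hn₃ (by exact_mod_cast hb₃))
    (c₁ := c₁) (c₂ := c₂) (c₃ := c₃)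
    (by exact_mod_cast hc₁) (by exact_mod_cast hc₂) (by exact_mod_cast hc₃)
    (sub_ne_zero.2 hα.1) (fun h => hβ.2 (eq_neg_of_add_eq_zero_left h)) (sub_ne_zero.2 hβ.1)
    rfl rfl rfl rfl h₀ h₁ rfl rfl
  rw [h₀, h₁]
  rw [h₀] at hQ
  refine ⟨_, _, hY, idealElt_zero_zero hY _, ?_⟩
  push_cast
  exact hQ
end
end
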